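/- arXiv:0808.2996 — 2 statements merged into one kernel-verified Lean document; each statement's English description precedes it below -/
import Mathlib

section
/- There is no nonzero polynomial in ℝ[x,y] of degree strictly less than m whose stabilizer subgroup in O(2) equals the dihedral group D_m (any D_m-invariant polynomial of degree < m is a polynomial in x² + y², hence O(2)-invariant). -/
open MvPolynomial Real Matrix

/-- The rotation of `ℝ²` by angle `θ`. -/
noncomputable def rotMat (θ : ℝ) : Matrix (Fin 2) (Fin 2) ℝ :=
  !![Real.cos θ, -Real.sin θ; Real.sin θ, Real.cos θ]

/-- The reflection `τ(x,y) = (x,-y)`. -/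
noncomputable def reflMat : Matrix (Fin 2) (Fin 2) ℝ := !![1, 0; 0, -1]

/-- The stabilizer in `O(2)` of a polynomial `P`, for the action
`(φ·P)(x,y) = P(φ⁻¹(x,y))`. -/
def polyStab (P : MvPolynomial (Fin 2) ℝ) : Set (Matrix (Fin 2) (Fin 2) ℝ) :=
  {A | A * Aᵀ = 1 ∧ ∀ v : Fin 2 → ℝ, eval (A.mulVec v) P = eval v P}

/-- The dihedral group `D_m = ⟨σ_m, τ⟩ ⊆ O(2)`, of order `2m`. -/
noncomputable def DihSet (m : ℕ) : Set (Matrix (Fin 2) (Fin 2) ℝ) :=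
  {A | ∃ k : ℕ, k < m ∧
    (A = rotMat (2 * π * k / m) ∨ A = rotMat (2 * π * k / m) * reflMat)}

/-- The restriction of a real polynomial of degree at most `d` to a circle of radius `r` is a
trigonometric polynomial of degree at most `d`. -/
theorem exists_polynomial_eval_exp (P : MvPolynomial (Fin 2) ℝ) (d : ℕ)
    (hd : P.totalDegree ≤ d) (r : ℝ) :
    ∃ G : Polynomial ℂ, G.natDegree ≤ 2 * d ∧ ∀ θ : ℝ,
      G.eval (Complex.exp (θ * Complex.I)) =
        Complex.exp (θ * Complex.I) ^ d *
          ((eval ![r * Real.cos θ, r * Real.sin θ] P : ℝ) : ℂ) := by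
  have hs : ∀ s ∈ P.support, s 0 + s 1 ≤ d := by
    intro s h
    have h1 := (le_totalDegree h).trans hd
    rwa [Finsupp.sum_fintype _ _ (fun _ => rfl), Fin.sum_univ_two] at h1
  refine ⟨∑ s ∈ P.support, Polynomial.C ((P.coeff s : ℝ) : ℂ) *
    ((Polynomial.C ((r : ℂ) / 2) * (Polynomial.X ^ 2 + 1)) ^ s 0 *
      (Polynomial.C (-(Complex.I * r) / 2) * (Polynomial.X ^ 2 - 1)) ^ s 1 *
      Polynomial.X ^ (d - (s 0 + s 1))), ?_, ?_⟩
  · refine Polynomial.natDegree_sum_le_of_forall_le _ _ fun s h => ?_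
    have h1 := hs s h
    have h2 : (Polynomial.C ((r : ℂ) / 2) * (Polynomial.X ^ 2 + 1)).natDegree ≤ 2 := by
      compute_degree
    have h3 : (Polynomial.C (-(Complex.I * r) / 2) *
        (Polynomial.X ^ 2 - 1)).natDegree ≤ 2 := by
      compute_degree
    refine (Polynomial.natDegree_C_mul_le _ _).trans ?_
    refine (Polynomial.natDegree_mul_le_of_le (Polynomial.natDegree_mul_le_of_le
      (Polynomial.natDegree_pow_le_of_le _ h2) (Polynomial.natDegree_pow_le_of_le _ h3))
      (Polynomial.natDegree_X_pow_le _)).trans ?_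
    omega
  · intro θ
    have hz : Complex.exp (θ * Complex.I) = Complex.cos θ + Complex.sin θ * Complex.I :=
      Complex.exp_mul_I _
    have hcs : Complex.sin θ ^ 2 + Complex.cos θ ^ 2 = 1 := Complex.sin_sq_add_cos_sq _
    generalize Complex.exp (θ * Complex.I) = z at hz ⊢
    have hc : (r : ℂ) / 2 * (z ^ 2 + 1) = z * (r * Complex.cos θ) := by
      rw [hz]
      linear_combination (-(r : ℂ) / 2) * hcs + (r : ℂ) / 2 * Complex.sin θ ^ 2 * Complex.I_sq
    have hsn : -(Complex.I * r) / 2 * (z ^ 2 - 1) = z * (r * Complex.sin θ) := by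
      rw [hz]
      linear_combination (-(Complex.I * r) / 2) * hcs +
        (-(r : ℂ) * Complex.cos θ * Complex.sin θ
          - (r : ℂ) / 2 * Complex.I * Complex.sin θ ^ 2) * Complex.I_sq
    rw [eval_eq', Polynomial.eval_finsetSum, Complex.ofReal_sum, Finset.mul_sum]
    refine Finset.sum_congr rfl fun s h => ?_
    obtain ⟨e, he⟩ := Nat.exists_eq_add_of_le (hs s h)
    simp only [Polynomial.eval_mul, Polynomial.eval_C, Polynomial.eval_pow, Polynomial.eval_add,
      Polynomial.eval_sub, Polynomial.eval_X, Polynomial.eval_one, Fin.prod_univ_two,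
      Matrix.cons_val_zero, Matrix.cons_val_one, Complex.ofReal_mul, Complex.ofReal_pow,
      Complex.ofReal_cos, Complex.ofReal_sin]
    rw [hc, hsn, he, Nat.add_sub_cancel_left]
    ring

/-- A complex polynomial vanishing on the unit circle is zero. -/
theorem polynomial_eq_zero_of_eval_exp (G : Polynomial ℂ)
    (h : ∀ θ : ℝ, G.eval (Complex.exp (θ * Complex.I)) = 0) : G = 0 := by
  refine Polynomial.eq_zero_of_infinite_isRoot G ?_
  refine Set.Infinite.mono (s := (fun θ : ℝ => Complex.exp (θ * Complex.I)) '' Set.Ioc (-π) π)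
    ?_ ?_
  · rintro _ ⟨θ, -, rfl⟩
    exact h θ
  · refine Set.Infinite.image ?_ (Set.Ioc_infinite (by linarith [Real.pi_pos]))
    intro a ha b hb hab
    have := congrArg Complex.arg hab
    simpa [Complex.arg_exp_mul_I, toIocMod_eq_self, ha, hb,
      (toIocMod_eq_self Real.two_pi_pos).2, show -π + 2 * π = π by ring] using this

theorem rotMat_mulVec_polar (α r θ : ℝ) :
    (rotMat α).mulVec ![r * Real.cos θ, r * Real.sin θ] =
      ![r * Real.cos (θ + α), r * Real.sin (θ + α)] := by
  ext i
  fin_cases i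
  · simp [rotMat, Matrix.mulVec, dotProduct, Fin.sum_univ_two, Real.cos_add]
    ring
  · simp [rotMat, Matrix.mulVec, dotProduct, Fin.sum_univ_two, Real.sin_add]
    ring

theorem exists_polar (v : Fin 2 → ℝ) :
    ∃ r θ : ℝ, v = ![r * Real.cos θ, r * Real.sin θ] := by
  refine ⟨‖(⟨v 0, v 1⟩ : ℂ)‖, Complex.arg ⟨v 0, v 1⟩, ?_⟩
  ext i
  fin_cases i <;> simp

/-- A polynomial of degree less than `m` invariant under the rotation by `2π/m` is constant on
circles centred at the origin. -/
theorem eval_polar_eq {m : ℕ} {P : MvPolynomial (Fin 2) ℝ} (hP : P.totalDegree < m)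
    (hrot : ∀ v : Fin 2 → ℝ, eval ((rotMat (2 * π / m)).mulVec v) P = eval v P) (r θ : ℝ) :
    eval ![r * Real.cos θ, r * Real.sin θ] P = eval ![r, 0] P := by
  have hm : m ≠ 0 := by omega
  obtain ⟨G, hG, hGe⟩ := exists_polynomial_eval_exp P _ le_rfl r
  set d := P.totalDegree with hd
  set ζ : ℂ := Complex.exp (2 * π * Complex.I / m) with hζ
  have hprim : IsPrimitiveRoot ζ m := Complex.isPrimitiveRoot_exp m hm
  have hzero : G.comp (Polynomial.C ζ * Polynomial.X) - Polynomial.C (ζ ^ d) * G = 0 := by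
    refine polynomial_eq_zero_of_eval_exp _ fun t => ?_
    have h1 : ζ * Complex.exp (t * Complex.I) =
        Complex.exp (((t + 2 * π / m : ℝ) : ℂ) * Complex.I) := by
      rw [hζ, ← Complex.exp_add]
      congr 1
      push_cast
      ring
    simp only [Polynomial.eval_sub, Polynomial.eval_comp, Polynomial.eval_mul, Polynomial.eval_C,
      Polynomial.eval_X]
    rw [h1, hGe, hGe, ← rotMat_mulVec_polar, hrot, ← h1]
    ring
  have hcoeff : ∀ n, n ≠ d → G.coeff n = 0 := by
    intro n hn
    by_cases hn2 : 2 * d < n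
    · exact Polynomial.coeff_eq_zero_of_natDegree_lt (hG.trans_lt hn2)
    have h := congrArg (fun p => Polynomial.coeff p n) hzero
    simp only [Polynomial.coeff_sub, Polynomial.comp_C_mul_X_coeff, Polynomial.coeff_C_mul,
      Polynomial.coeff_zero] at h
    have h' : G.coeff n * (ζ ^ n - ζ ^ d) = 0 := by linear_combination h
    refine (mul_eq_zero.1 h').resolve_right fun h0 => hn ?_
    have hmod : n ≡ d [MOD m] := by
      rw [hprim.eq_orderOf, ← (hprim.isUnit hm).unit_spec, orderOf_units,
        ← pow_eq_pow_iff_modEq]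
      exact Units.ext (by simpa using sub_eq_zero.1 h0)
    obtain ⟨c, hc⟩ := hmod.dvd
    have hc0 : c = 0 := by
      by_contra hne
      have h1 : (m : ℤ) ≤ |(d : ℤ) - n| :=
        Int.le_of_dvd (abs_pos.2 (by omega)) ((dvd_abs _ _).2 ⟨c, hc⟩)
      rw [le_abs] at h1
      omega
    subst hc0
    omega
  have hmono : G = Polynomial.C (G.coeff d) * Polynomial.X ^ d := by
    ext n
    rw [Polynomial.coeff_C_mul_X_pow]
    split_ifs with h
    · rw [h]
    · exact hcoeff n h
  have hconst : ∀ t : ℝ,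
      ((eval ![r * Real.cos t, r * Real.sin t] P : ℝ) : ℂ) = G.coeff d := by
    intro t
    have h := hGe t
    rw [hmono] at h
    simp only [Polynomial.eval_mul, Polynomial.eval_C, Polynomial.eval_pow, Polynomial.eval_X] at h
    refine mul_left_cancel₀ (pow_ne_zero d (Complex.exp_ne_zero (t * Complex.I))) ?_
    rw [← h, mul_comm]
  have h := (hconst θ).trans (hconst 0).symm
  simpa using h

/-- An even polynomial is a polynomial in the square of the variable. -/
theorem exists_eval_sq_of_even (p : Polynomial ℝ) (hp : ∀ x, p.eval (-x) = p.eval x) :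
    ∃ q : Polynomial ℝ, ∀ x, p.eval x = q.eval (x ^ 2) := by
  have hcomp : p.comp (Polynomial.C (-1) * Polynomial.X) = p := Polynomial.funext fun x => by simp [hp]
  refine ⟨p.contract 2, fun x => ?_⟩
  rw [← Polynomial.expand_eval]
  congr 1
  ext n
  rw [Polynomial.coeff_expand two_pos]
  split_ifs with h
  · rw [Polynomial.coeff_contract two_ne_zero, Nat.div_mul_cancel h]
  · have h1 := congrArg (fun f => Polynomial.coeff f n) hcomp
    have hodd : Odd n := by rwa [← Nat.not_even_iff_odd, even_iff_two_dvd]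
    simp only [Polynomial.comp_C_mul_X_coeff, hodd.neg_one_pow] at h1
    linarith

theorem mem_adjoin_of_rotMat_invariant {m : ℕ} {P : MvPolynomial (Fin 2) ℝ}
    (hP : P.totalDegree < m)
    (hrot : ∀ v : Fin 2 → ℝ, eval ((rotMat (2 * π / m)).mulVec v) P = eval v P) :
    P ∈ Algebra.adjoin ℝ ({X 0 ^ 2 + X 1 ^ 2} : Set (MvPolynomial (Fin 2) ℝ)) := by
  have hp : ∀ x : ℝ, (aeval ![(Polynomial.X : Polynomial ℝ), 0] P).eval x =
      eval ![x, 0] P := by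
    intro x
    have h : (Polynomial.aeval x).comp (aeval ![(Polynomial.X : Polynomial ℝ), 0]) =
        aeval ![x, 0] := by
      ext i
      fin_cases i <;> simp
    simpa [Polynomial.coe_aeval_eq_eval, MvPolynomial.coe_aeval_eq_eval] using
      DFunLike.congr_fun h P
  obtain ⟨q, hq⟩ := exists_eval_sq_of_even (aeval ![(Polynomial.X : Polynomial ℝ), 0] P) (by
    intro x
    rw [hp, hp, ← eval_polar_eq hP hrot x π]
    simp)
  have hPq : P = Polynomial.aeval (X 0 ^ 2 + X 1 ^ 2) q := by
    refine MvPolynomial.funext fun v => ?_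
    obtain ⟨r, θ, rfl⟩ := exists_polar v
    rw [eval_polar_eq hP hrot, ← hp, hq, ← MvPolynomial.coe_aeval_eq_eval, RingHom.coe_coe,
      ← Polynomial.aeval_algHom_apply, Polynomial.coe_aeval_eq_eval]
    congr 1
    simp
    linear_combination (-r ^ 2) * Real.sin_sq_add_cos_sq θ
  rw [hPq]
  exact Polynomial.aeval_mem_adjoin_singleton _ _

theorem det_rotMat (θ : ℝ) : (rotMat θ).det = 1 := by
  rw [rotMat, Matrix.det_fin_two_of]
  linear_combination Real.sin_sq_add_cos_sq θ

theorem det_reflMat : reflMat.det = -1 := by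
  simp [reflMat]

theorem rotMat_mul_transpose (θ : ℝ) : rotMat θ * (rotMat θ)ᵀ = 1 := by
  have h := Real.sin_sq_add_cos_sq θ
  ext i j
  fin_cases i <;> fin_cases j <;> simp [rotMat, Matrix.mul_apply, Fin.sum_univ_two] <;>
    first | ring1 | linear_combination h

theorem rotMat_two_pi_div_mem_DihSet {m : ℕ} (hm : 1 ≤ m) : rotMat (2 * π / m) ∈ DihSet m := by
  rcases hm.eq_or_lt with rfl | h
  · exact ⟨0, one_pos, Or.inl (by simp [rotMat])⟩
  · exact ⟨1, h, Or.inl (by simp)⟩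

theorem rotMat_pi_div_notMem_DihSet (m : ℕ) : rotMat (π / m) ∉ DihSet m := by
  rintro ⟨k, hk, h | h⟩
  · have hm : (m : ℝ) ≠ 0 := by
      exact_mod_cast (by omega : m ≠ 0)
    have hc : Real.cos (π / m) = Real.cos (2 * π * k / m) := by
      simpa [rotMat] using congrFun (congrFun h 0) 0
    have hs : Real.sin (π / m) = Real.sin (2 * π * k / m) := by
      simpa [rotMat] using congrFun (congrFun h 1) 0
    have hang := Real.Angle.cos_sin_inj hc hs
    obtain ⟨n, hn⟩ := Real.Angle.angle_eq_iff_two_pi_dvd_sub.1 hang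
    have h1 : (1 : ℝ) - 2 * k = 2 * n * m := by
      field_simp at hn
      linear_combination hn
    have h2 : (1 : ℤ) - 2 * k = 2 * (n * m) := by
      rw [← mul_assoc]
      exact_mod_cast h1
    omega
  · have h1 := congrArg Matrix.det h
    rw [Matrix.det_mul, det_rotMat, det_rotMat, det_reflMat] at h1
    norm_num at h1

/-- Any `D_m`-invariant polynomial of degree `< m` is a polynomial in `x² + y²`
(hence is `O(2)`-invariant); consequently there is no nonzero polynomial of degree
strictly less than `m` whose stabilizer subgroup in `O(2)` equals `D_m`. -/
theorem stmt6 (m : ℕ) (hm : 1 ≤ m) :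
    (∀ P : MvPolynomial (Fin 2) ℝ, P.totalDegree < m →
      (∀ k : ℤ, ∀ v : Fin 2 → ℝ,
          eval ((rotMat (2 * π * k / m)).mulVec v) P = eval v P) →
      (∀ v : Fin 2 → ℝ, eval (reflMat.mulVec v) P = eval v P) →
      P ∈ Algebra.adjoin ℝ
        ({X 0 ^ 2 + X 1 ^ 2} : Set (MvPolynomial (Fin 2) ℝ))) ∧
    ¬ ∃ P : MvPolynomial (Fin 2) ℝ, P ≠ 0 ∧ P.totalDegree < m ∧
        polyStab P = DihSet m := by
  refine ⟨fun P hP hrot _ => mem_adjoin_of_rotMat_invariant hP ?_, ?_⟩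
  · simpa using hrot 1
  · rintro ⟨P, -, hP, hstab⟩
    have hrot : rotMat (2 * π / m) ∈ polyStab P := hstab ▸ rotMat_two_pi_div_mem_DihSet hm
    refine rotMat_pi_div_notMem_DihSet m ?_
    rw [← hstab]
    refine ⟨rotMat_mul_transpose _, fun v => ?_⟩
    obtain ⟨r, θ, rfl⟩ := exists_polar v
    rw [rotMat_mulVec_polar, eval_polar_eq hP hrot.2, eval_polar_eq hP hrot.2]
end

section
/- Two jets of metrics are exponential-compatible: if two semi-Riemannian metrics g, ḡ on a manifold X satisfy j^r_{x_0} g = j^r_{x_0} ḡ (their r-jets at x_0 coincide), then the (r+1)-jets at 0 of their exponential maps exp_g, exp_ḡ : T_{x_0}X → X coincide. -/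
open Asymptotics Filter Topology

section Jets

variable {E F : Type} [NormedAddCommGroup E] [NormedSpace ℝ E]
  [NormedAddCommGroup F] [NormedSpace ℝ F]

/-- If `f 0 = 0` and the derivative of `f` is `O(‖x‖ ^ m)`, then `f` is `O(‖x‖ ^ (m + 1))`. -/
theorem isBigO_norm_pow_succ_of_fderiv {f : E → F} (hf : Differentiable ℝ f) (h0 : f 0 = 0)
    {m : ℕ} (h : fderiv ℝ f =O[𝓝 0] fun x => ‖x‖ ^ m) :
    f =O[𝓝 0] fun x => ‖x‖ ^ (m + 1) := by
  obtain ⟨C, hC0, hC⟩ := h.exists_nonneg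
  obtain ⟨ε, hε, hball⟩ := Metric.eventually_nhds_iff_ball.1 hC.bound
  refine IsBigO.of_bound C ?_
  filter_upwards [Metric.ball_mem_nhds (0 : E) hε] with x hx
  have hbound : ∀ y ∈ Metric.closedBall (0 : E) ‖x‖, ‖fderiv ℝ f y‖ ≤ C * ‖x‖ ^ m := by
    intro y hy
    have hyx : ‖y‖ ≤ ‖x‖ := by simpa using hy
    have hyb : y ∈ Metric.ball (0 : E) ε := by
      simp only [mem_ball_zero_iff] at hx ⊢
      exact hyx.trans_lt hx
    have h1 := hball y hyb
    rw [norm_pow, norm_norm] at h1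
    refine h1.trans ?_
    gcongr
  have := (convex_closedBall (0 : E) ‖x‖).norm_image_sub_le_of_norm_fderiv_le
    (fun y _ => hf y) hbound (x := 0) (y := x) (by simp) (by simp)
  simpa [h0, pow_succ, mul_assoc] using this

/-- A smooth function whose derivatives of order `< m` vanish at `0` is `O(‖x‖ ^ m)`. -/
theorem isBigO_norm_pow_of_iteratedFDeriv_eq_zero {m : ℕ} : ∀ {F : Type} [NormedAddCommGroup F]
    [NormedSpace ℝ F] {f : E → F}, ContDiff ℝ (⊤ : ℕ∞) f →
    (∀ s < m, iteratedFDeriv ℝ s f 0 = 0) → f =O[𝓝 0] fun x => ‖x‖ ^ m := by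
  induction m with
  | zero =>
    intro F _ _ f hf _
    simpa using hf.continuous.continuousAt.isBigO_one ℝ
  | succ m ih =>
    intro F _ _ f hf h
    refine isBigO_norm_pow_succ_of_fderiv (hf.differentiable (by simp)) ?_
      (ih (hf.fderiv_right (m := (⊤ : ℕ∞)) (by simp)) fun s hs => ?_)
    · have := h 0 (by omega)
      rw [← norm_eq_zero] at this ⊢
      simpa using this
    · rw [← norm_eq_zero, norm_iteratedFDeriv_fderiv, h _ (by omega), norm_zero]

/-- The derivatives of order `< m` at `0` of a smooth curve that is `O(|t| ^ m)` vanish. -/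
theorem iteratedDeriv_eq_zero_of_isBigO {f : ℝ → F} (hf : ContDiff ℝ (⊤ : ℕ∞) f) {m : ℕ}
    (h : f =O[𝓝 0] fun t => ‖t‖ ^ m) (s : ℕ) (hs : s < m) : iteratedDeriv s f 0 = 0 := by
  induction s using Nat.strong_induction_on with
  | _ s ih =>
    have hT := taylor_isLittleO_univ (x₀ := 0) (hf.of_le (m := s) (by exact_mod_cast le_top))
    have hpow : (fun t : ℝ => ‖t‖ ^ m) =o[𝓝 0] fun t : ℝ => t ^ s := by
      have := isLittleO_pow_pow (𝕜 := ℝ) hs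
      simpa [norm_pow] using this.norm_left
    have hc : (fun t : ℝ => t ^ s • ((s.factorial : ℝ)⁻¹ • iteratedDeriv s f 0))
        =o[𝓝 0] fun t : ℝ => t ^ s := by
      have h2 := (h.trans_isLittleO hpow).sub (by simpa using hT)
      refine h2.congr_left fun t => ?_
      rw [taylor_within_apply, Finset.sum_range_succ, Finset.sum_eq_zero]
      · simp [iteratedDerivWithin_univ, smul_smul, mul_comm]
      · intro k hk
        rw [iteratedDerivWithin_univ, ih k (by simpa using hk)
          ((by simpa using hk : k < s).trans hs), smul_zero]
    by_contra hne
    set c := (s.factorial : ℝ)⁻¹ • iteratedDeriv s f 0 with hcdef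
    have hc0 : c ≠ 0 := smul_ne_zero (by positivity) hne
    have h3 : ∀ᶠ t : ℝ in 𝓝 0, ‖t ^ s • c‖ ≤ ‖c‖ / 2 * ‖t ^ s‖ := hc.def (by positivity)
    obtain ⟨t, ht, ht0⟩ := ((h3.filter_mono nhdsWithin_le_nhds).and
      (self_mem_nhdsWithin (a := (0 : ℝ)) (s := {0}ᶜ))).exists
    have hts : 0 < ‖t ^ s‖ := norm_pos_iff.2 (pow_ne_zero _ ht0)
    rw [norm_smul] at ht
    nlinarith [norm_pos_iff.2 hc0, mul_pos hts (norm_pos_iff.2 hc0)]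

/-- Iterated derivatives of the directional derivative of `f` along `w`. -/
theorem iteratedFDeriv_fderiv_apply {f : E → F} (hf : ContDiff ℝ (⊤ : ℕ∞) f) (s : ℕ) (x w : E)
    (v : Fin s → E) :
    iteratedFDeriv ℝ s (fun y => fderiv ℝ f y w) x v =
      iteratedFDeriv ℝ (s + 1) f x (Fin.snoc v w) := by
  rw [iteratedFDeriv_succ_apply_right]
  have := (ContinuousLinearMap.apply ℝ F w).iteratedFDeriv_comp_left
    (f := fderiv ℝ f) (x := x) (i := s) (n := (⊤ : ℕ∞))
    (hf.fderiv_right (m := (⊤ : ℕ∞)) (by simp)).contDiffAt (by exact_mod_cast le_top)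
  have h2 := congrArg (fun A => A v) this
  simpa [Function.comp_def] using h2

/-- Iterated derivatives of a smooth function are symmetric in their last two arguments. -/
theorem iteratedFDeriv_snoc_snoc_comm {f : E → F} (hf : ContDiff ℝ (⊤ : ℕ∞) f) (s : ℕ)
    (x w₁ w₂ : E) (v : Fin s → E) :
    iteratedFDeriv ℝ (s + 2) f x (Fin.snoc (Fin.snoc v w₁ : Fin (s + 1) → E) w₂) =
      iteratedFDeriv ℝ (s + 2) f x (Fin.snoc (Fin.snoc v w₂ : Fin (s + 1) → E) w₁) := by
  have hD : ContDiff ℝ (⊤ : ℕ∞) (fderiv ℝ f) := hf.fderiv_right (by simp)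
  have hw : ∀ w, ContDiff ℝ (⊤ : ℕ∞) fun y => fderiv ℝ f y w := fun w =>
    hD.clm_apply contDiff_const
  rw [← iteratedFDeriv_fderiv_apply hf, ← iteratedFDeriv_fderiv_apply (hw _),
    ← iteratedFDeriv_fderiv_apply hf, ← iteratedFDeriv_fderiv_apply (hw _)]
  congr 2
  ext y
  have hsymm : IsSymmSndFDerivAt ℝ f y :=
    hf.contDiffAt.isSymmSndFDerivAt (by
      simpa using (by exact_mod_cast le_top : ((2 : ℕ∞) : WithTop ℕ∞) ≤ ((⊤ : ℕ∞) : WithTop ℕ∞)))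
  rw [fderiv_clm_apply (hD.differentiable (by simp) y) (differentiableAt_const _),
    fderiv_clm_apply (hD.differentiable (by simp) y) (differentiableAt_const _)]
  simpa using hsymm w₁ w₂

/-- The value of an iterated derivative at a tuple with all but one entry equal to `v` does not
depend on the position of the remaining entry. -/
theorem iteratedFDeriv_update_const {s : ℕ} : ∀ {f : E → F}, ContDiff ℝ (⊤ : ℕ∞) f →
    ∀ (x v w : E) (i : Fin (s + 1)),
    iteratedFDeriv ℝ (s + 1) f x (Function.update (fun _ => v) i w) =
      iteratedFDeriv ℝ (s + 1) f x (Fin.snoc (fun _ => v : Fin s → E) w) := by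
  induction s with
  | zero =>
    intro f hf x v w i
    congr 1
    ext j
    fin_cases i; fin_cases j
    simp [Fin.snoc]
  | succ s ih =>
    intro f hf x v w i
    have hconst : ∀ k : ℕ,
        (fun _ => v : Fin (k + 1) → E) = Fin.snoc (fun _ => v : Fin k → E) v := by
      intro k
      ext j
      refine Fin.lastCases ?_ (fun j => ?_) j <;> simp
    refine Fin.lastCases ?_ (fun i => ?_) i
    · rw [hconst (s + 1), Fin.update_snoc_last]
    · have hv : ContDiff ℝ (⊤ : ℕ∞) fun y => fderiv ℝ f y v :=
        (hf.fderiv_right (m := (⊤ : ℕ∞)) (by simp)).clm_apply contDiff_const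
      rw [hconst (s + 1), ← Fin.snoc_update, ← iteratedFDeriv_fderiv_apply hf, ih hv,
        iteratedFDeriv_fderiv_apply hf, iteratedFDeriv_snoc_snoc_comm hf, ← hconst]

/-- **Polarization**: an iterated derivative vanishing on the diagonal is zero. -/
theorem iteratedFDeriv_eq_zero_of_diag {s : ℕ} : ∀ {f : E → F}, ContDiff ℝ (⊤ : ℕ∞) f → ∀ {x : E},
    (∀ v, iteratedFDeriv ℝ s f x (fun _ => v) = 0) → iteratedFDeriv ℝ s f x = 0 := by
  induction s with
  | zero =>
    intro f hf x h
    ext v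
    simpa using h 0
  | succ s ih =>
    intro f hf x h
    ext u
    rw [← Fin.snoc_init_self u, ← iteratedFDeriv_fderiv_apply hf,
      ih ((hf.fderiv_right (m := (⊤ : ℕ∞)) (by simp)).clm_apply contDiff_const)]
    · simp
    intro v
    rw [iteratedFDeriv_fderiv_apply hf]
    set w := u (Fin.last s)
    have hA := (iteratedFDeriv ℝ (s + 1) f x).hasFDerivAt (fun _ => v)
    have hcomp := hA.comp v
      (ContinuousLinearMap.pi fun _ : Fin (s + 1) => ContinuousLinearMap.id ℝ E).hasFDerivAt
    have hzero : (iteratedFDeriv ℝ (s + 1) f x) ∘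
        (ContinuousLinearMap.pi fun _ : Fin (s + 1) => ContinuousLinearMap.id ℝ E) = 0 := by
      ext y
      exact h y
    rw [hzero] at hcomp
    have := congrArg (fun L => L w) (hcomp.unique (hasFDerivAt_const (0 : F) v))
    simp only [ContinuousLinearMap.comp_apply, ContinuousMultilinearMap.linearDeriv_apply] at this
    simp only [ContinuousLinearMap.coe_pi', ContinuousLinearMap.id_apply,
      iteratedFDeriv_update_const hf] at this
    rw [Finset.sum_const, Finset.card_univ, Fintype.card_fin, ← Nat.cast_smul_eq_nsmul ℝ] at this
    exact (smul_eq_zero.1 this).resolve_left (by positivity)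

/-- A smooth function that is `O(|t| ^ m)` along every line through `0` has vanishing derivatives
of order `< m` at `0`. -/
theorem iteratedFDeriv_eq_zero_of_isBigO_lines {f : E → F} (hf : ContDiff ℝ (⊤ : ℕ∞) f) {m : ℕ}
    (h : ∀ v, (fun t : ℝ => f (t • v)) =O[𝓝 0] fun t => ‖t‖ ^ m) (s : ℕ) (hs : s < m) :
    iteratedFDeriv ℝ s f 0 = 0 := by
  refine iteratedFDeriv_eq_zero_of_diag hf fun v => ?_
  have hline := iteratedDeriv_eq_zero_of_isBigO
    (hf.comp (contDiff_id.smul contDiff_const)) (h v) s hs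
  have hcomp := (ContinuousLinearMap.toSpanSingleton ℝ v).iteratedFDeriv_comp_right
    (n := (⊤ : ℕ∞)) hf 0 (i := s) (by exact_mod_cast le_top)
  have h1 := congrArg (fun A => A fun _ => 1) hcomp
  rw [iteratedDeriv_eq_iteratedFDeriv] at hline
  simpa using h1.symm.trans hline

end Jets

section LinearSystems

variable {E ι : Type} [NormedAddCommGroup E] [NormedSpace ℝ E] [Fintype ι] [DecidableEq ι]

theorem contDiff_matrix_det {A : ι → ι → E → ℝ} (hA : ∀ i j, ContDiff ℝ (⊤ : ℕ∞) (A i j)) :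
    ContDiff ℝ (⊤ : ℕ∞) fun x => (Matrix.of fun i j => A i j x).det := by
  simp only [Matrix.det_apply, Matrix.of_apply, Units.smul_def, zsmul_eq_mul]
  exact ContDiff.sum fun σ _ => contDiff_const.mul (contDiff_prod fun i _ => hA _ _)

theorem contDiff_matrix_inv_apply {A : ι → ι → E → ℝ} (hA : ∀ i j, ContDiff ℝ (⊤ : ℕ∞) (A i j))
    (hu : ∀ x, IsUnit (Matrix.of fun i j => A i j x)) (k l : ι) :
    ContDiff ℝ (⊤ : ℕ∞) fun x => (Matrix.of fun i j => A i j x)⁻¹ k l := by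
  simp only [Matrix.inv_def, Matrix.smul_apply, Ring.inverse_eq_inv', smul_eq_mul,
    Matrix.adjugate_apply]
  refine ((contDiff_matrix_det hA).inv fun x => ?_).mul ?_
  · exact ((Matrix.isUnit_iff_isUnit_det _).1 (hu x)).ne_zero
  · have hB : ∀ i j, ContDiff ℝ (⊤ : ℕ∞)
        fun x => (Matrix.of fun i j => A i j x).updateRow l (Pi.single k 1) i j := by
      intro i j
      by_cases h : i = l
      · subst h
        simpa using contDiff_const
      · simpa [Matrix.updateRow_apply, h] using hA i j
    exact contDiff_matrix_det hB

theorem eq_sum_inv_mul {M : Matrix ι ι ℝ} (hM : IsUnit M) {u b : ι → ℝ}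
    (h : ∀ k, ∑ l, M k l * u l = b k) (l : ι) : u l = ∑ k, M⁻¹ l k * b k := by
  have hb : M.mulVec u = b := funext h
  have : M⁻¹.mulVec b = u := by
    rw [← hb, Matrix.mulVec_mulVec,
      Matrix.nonsing_inv_mul _ ((Matrix.isUnit_iff_isUnit_det _).1 hM), Matrix.one_mulVec]
  exact (congrFun this l).symm

/-- The solution of a smooth invertible linear system is smooth. -/
theorem contDiff_of_linear_system {A : ι → ι → E → ℝ} {u b : ι → E → ℝ}
    (hA : ∀ i j, ContDiff ℝ (⊤ : ℕ∞) (A i j)) (hb : ∀ k, ContDiff ℝ (⊤ : ℕ∞) (b k))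
    (hu : ∀ x, IsUnit (Matrix.of fun i j => A i j x))
    (h : ∀ x k, ∑ l, A k l x * u l x = b k x) (l : ι) : ContDiff ℝ (⊤ : ℕ∞) (u l) := by
  have : u l = fun x => ∑ k, (Matrix.of fun i j => A i j x)⁻¹ l k * b k x :=
    funext fun x => eq_sum_inv_mul (u := fun l => u l x) (hu x) (h x) l
  rw [this]
  exact ContDiff.sum fun k _ => (contDiff_matrix_inv_apply hA hu l k).mul (hb k)

/-- If the data of two smooth invertible linear systems differ by `O(φ)`, so do the solutions. -/
theorem isBigO_sub_of_linear_system {A A' : ι → ι → E → ℝ} {u u' b b' : ι → E → ℝ} {φ : E → ℝ}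
    (hA : ∀ i j, ContDiff ℝ (⊤ : ℕ∞) (A i j)) (hu' : ∀ l, ContDiff ℝ (⊤ : ℕ∞) (u' l))
    (hu : ∀ x, IsUnit (Matrix.of fun i j => A i j x))
    (h : ∀ x k, ∑ l, A k l x * u l x = b k x) (h' : ∀ x k, ∑ l, A' k l x * u' l x = b' k x)
    {x₀ : E} (hAA : ∀ i j, (fun x => A i j x - A' i j x) =O[𝓝 x₀] φ)
    (hbb : ∀ k, (fun x => b k x - b' k x) =O[𝓝 x₀] φ) (l : ι) :
    (fun x => u l x - u' l x) =O[𝓝 x₀] φ := by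
  have hdiff : ∀ x k, ∑ l, A k l x * (u l x - u' l x) =
      (b k x - b' k x) - ∑ l, (A k l x - A' k l x) * u' l x := by
    intro x k
    simp only [mul_sub, sub_mul, Finset.sum_sub_distrib, h, h']
    ring
  have hsol : (fun x => u l x - u' l x) = fun x => ∑ k, (Matrix.of fun i j => A i j x)⁻¹ l k *
      ((b k x - b' k x) - ∑ l, (A k l x - A' k l x) * u' l x) :=
    funext fun x => eq_sum_inv_mul (u := fun l => u l x - u' l x) (hu x) (hdiff x) l
  rw [hsol]
  refine IsBigO.fun_sum fun k _ => ?_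
  have hinv := ((contDiff_matrix_inv_apply hA hu l k).continuous.tendsto x₀).isBigO_one ℝ
  have hrhs : (fun x => (b k x - b' k x) - ∑ l, (A k l x - A' k l x) * u' l x) =O[𝓝 x₀] φ := by
    refine (hbb k).sub (IsBigO.fun_sum fun l _ => ?_)
    simpa using (hAA k l).mul (((hu' l).continuous.tendsto x₀).isBigO_one ℝ)
  simpa using hinv.mul hrhs

end LinearSystems

theorem isBigO_mul_sub_mul {α : Type} {l : Filter α} {a b p q φ : α → ℝ}
    (hab : (fun x => a x - b x) =O[l] φ) (hpq : (fun x => p x - q x) =O[l] φ)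
    (ha : a =O[l] fun _ => (1 : ℝ)) (hq : q =O[l] fun _ => (1 : ℝ)) :
    (fun x => a x * p x - b x * q x) =O[l] φ := by
  have h1 := ha.mul hpq
  have h2 := hab.mul hq
  simp only [one_mul, mul_one] at h1 h2
  exact (h1.add h2).congr_left fun x => by ring

section Geodesics

variable {n : ℕ}

/-- The Christoffel symbols of a smooth nondegenerate metric are smooth. -/
theorem contDiff_christoffel {g : Fin n → Fin n → (Fin n → ℝ) → ℝ}
    {Γ : Fin n → Fin n → Fin n → (Fin n → ℝ) → ℝ}
    (hg : ∀ i j, ContDiff ℝ (⊤ : ℕ∞) (g i j))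
    (hgnd : ∀ x, IsUnit (Matrix.of fun i j => g i j x))
    (hΓ : ∀ (x : Fin n → ℝ) (k i j : Fin n),
      ∑ l : Fin n, g k l x * Γ l i j x =
        (1 / 2) * (fderiv ℝ (g j k) x (Pi.single i 1) +
          fderiv ℝ (g i k) x (Pi.single j 1) -
          fderiv ℝ (g i j) x (Pi.single k 1))) (k i j : Fin n) :
    ContDiff ℝ (⊤ : ℕ∞) (Γ k i j) := by
  have hD : ∀ i j k, ContDiff ℝ (⊤ : ℕ∞) fun x => fderiv ℝ (g i j) x (Pi.single k 1) :=
    fun i j k => ((hg i j).fderiv_right (m := (⊤ : ℕ∞)) (by simp)).clm_apply contDiff_const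
  exact contDiff_of_linear_system (u := fun l => Γ l i j) hg
    (fun k => contDiff_const.mul (((hD j k i).add (hD i k j)).sub (hD i j k))) hgnd
    (fun x k => hΓ x k i j) k

/-- The Christoffel symbols of two metrics with the same `r`-jet at `0` agree to order
`O(‖x‖ ^ r)`. -/
theorem isBigO_christoffel_sub {r : ℕ} {g gb : Fin n → Fin n → (Fin n → ℝ) → ℝ}
    {Γ Γb : Fin n → Fin n → Fin n → (Fin n → ℝ) → ℝ}
    (hg : ∀ i j, ContDiff ℝ (⊤ : ℕ∞) (g i j)) (hgb : ∀ i j, ContDiff ℝ (⊤ : ℕ∞) (gb i j))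
    (hgnd : ∀ x, IsUnit (Matrix.of fun i j => g i j x))
    (hgbnd : ∀ x, IsUnit (Matrix.of fun i j => gb i j x))
    (hΓ : ∀ (x : Fin n → ℝ) (k i j : Fin n),
      ∑ l : Fin n, g k l x * Γ l i j x =
        (1 / 2) * (fderiv ℝ (g j k) x (Pi.single i 1) +
          fderiv ℝ (g i k) x (Pi.single j 1) -
          fderiv ℝ (g i j) x (Pi.single k 1)))
    (hΓb : ∀ (x : Fin n → ℝ) (k i j : Fin n),
      ∑ l : Fin n, gb k l x * Γb l i j x =
        (1 / 2) * (fderiv ℝ (gb j k) x (Pi.single i 1) +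
          fderiv ℝ (gb i k) x (Pi.single j 1) -
          fderiv ℝ (gb i j) x (Pi.single k 1)))
    (hjet : ∀ s ≤ r, ∀ i j,
      iteratedFDeriv ℝ s (g i j) 0 = iteratedFDeriv ℝ s (gb i j) 0) (k i j : Fin n) :
    (fun x => Γ k i j x - Γb k i j x) =O[𝓝 0] fun x => ‖x‖ ^ r := by
  have hjet0 : ∀ i j, ∀ s ≤ r, iteratedFDeriv ℝ s (g i j - gb i j) 0 = 0 := by
    intro i j s hs
    rw [iteratedFDeriv_sub_apply ((hg i j).contDiffAt.of_le (by exact_mod_cast le_top))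
      ((hgb i j).contDiffAt.of_le (by exact_mod_cast le_top)), hjet s hs, sub_self]
  have hgg : ∀ i j, (fun x => g i j x - gb i j x) =O[𝓝 0] fun x => ‖x‖ ^ r := fun i j =>
    isBigO_norm_pow_of_iteratedFDeriv_eq_zero ((hg i j).sub (hgb i j))
      fun s hs => hjet0 i j s hs.le
  have hDD : ∀ i j k, (fun x => fderiv ℝ (g i j) x (Pi.single k 1) -
      fderiv ℝ (gb i j) x (Pi.single k 1)) =O[𝓝 0] fun x => ‖x‖ ^ r := by
    intro i j k
    have h : fderiv ℝ (g i j - gb i j) =O[𝓝 0] fun x => ‖x‖ ^ r := by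
      refine isBigO_norm_pow_of_iteratedFDeriv_eq_zero
        (((hg i j).sub (hgb i j)).fderiv_right (m := (⊤ : ℕ∞)) (by simp)) fun s hs => ?_
      rw [← norm_eq_zero, norm_iteratedFDeriv_fderiv, hjet0 i j _ hs, norm_zero]
    refine IsBigO.trans (IsBigO.of_bound ‖(Pi.single k 1 : Fin n → ℝ)‖ (.of_forall fun x => ?_)) h
    rw [← sub_apply, ← fderiv_sub ((hg i j).differentiable (by simp) x)
      ((hgb i j).differentiable (by simp) x), mul_comm]
    exact ContinuousLinearMap.le_opNorm _ _
  refine isBigO_sub_of_linear_system (u := fun l => Γ l i j) (u' := fun l => Γb l i j) hg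
    (fun l => contDiff_christoffel hgb hgbnd hΓb l i j) hgnd (fun x k => hΓ x k i j)
    (fun x k => hΓb x k i j) hgg (fun k => ?_) k
  refine ((((hDD j k i).add (hDD i k j)).sub (hDD i j k)).const_mul_left (1 / 2)).congr_left
    fun x => ?_
  ring

/-- Two solutions of geodesic equations with the same initial data at `0`, for connection
coefficients that agree to order `O(‖x‖ ^ r)`, agree to order `O(|t| ^ (r + 2))`. -/
theorem isBigO_geodesic_sub {r : ℕ} {Γ Γb : Fin n → Fin n → Fin n → (Fin n → ℝ) → ℝ}
    (hΓ : ∀ k i j, ContDiff ℝ (⊤ : ℕ∞) (Γ k i j)) (hΓb : ∀ k i j, ContDiff ℝ (⊤ : ℕ∞) (Γb k i j))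
    (hΓΓ : ∀ k i j, (fun x => Γ k i j x - Γb k i j x) =O[𝓝 0] fun x => ‖x‖ ^ r)
    {c cb : ℝ → Fin n → ℝ} (hc : ContDiff ℝ (⊤ : ℕ∞) c) (hcb : ContDiff ℝ (⊤ : ℕ∞) cb)
    (hc0 : c 0 = 0) (hcb0 : cb 0 = 0)
    (hvel : ∀ k, deriv (fun t => c t k) 0 = deriv (fun t => cb t k) 0)
    (hgeo : ∀ t k, deriv (deriv fun t => c t k) t +
      ∑ i, ∑ j, Γ k i j (c t) * deriv (fun t => c t i) t * deriv (fun t => c t j) t = 0)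
    (hgeob : ∀ t k, deriv (deriv fun t => cb t k) t +
      ∑ i, ∑ j, Γb k i j (cb t) * deriv (fun t => cb t i) t * deriv (fun t => cb t j) t = 0) :
    (fun t => c t - cb t) =O[𝓝 0] fun t => ‖t‖ ^ (r + 2) := by
  have hck := contDiff_pi.1 hc
  have hcbk := contDiff_pi.1 hcb
  have hc' : ∀ k, ContDiff ℝ (⊤ : ℕ∞) (deriv fun t => c t k) := fun k =>
    (contDiff_infty_iff_deriv.1 (hck k)).2
  have hcb' : ∀ k, ContDiff ℝ (⊤ : ℕ∞) (deriv fun t => cb t k) := fun k =>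
    (contDiff_infty_iff_deriv.1 (hcbk k)).2
  have integrate : ∀ {f f' : ℝ → ℝ} {m : ℕ}, (∀ t, HasDerivAt f (f' t) t) → f 0 = 0 →
      f' =O[𝓝 0] (fun t => ‖t‖ ^ m) → f =O[𝓝 0] fun t => ‖t‖ ^ (m + 1) := by
    intro f f' m hf h0 hO
    refine isBigO_norm_pow_succ_of_fderiv (fun t => (hf t).differentiableAt) h0 ?_
    rw [← isBigO_norm_left]
    simpa only [← norm_deriv_eq_norm_fderiv, (hf _).deriv] using hO.norm_left
  have hsub : ∀ {m : ℕ}, (∀ k, (fun t => deriv (fun t => c t k) t - deriv (fun t => cb t k) t)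
      =O[𝓝 0] fun t => ‖t‖ ^ m) → (fun t => c t - cb t) =O[𝓝 0] fun t => ‖t‖ ^ (m + 1) := by
    intro m h
    refine isBigO_pi.2 fun k => integrate (fun t => ?_) (by simp [hc0, hcb0]) (h k)
    exact ((hck k).differentiable (by simp) t).hasDerivAt.sub
      ((hcbk k).differentiable (by simp) t).hasDerivAt
  have hctend : Tendsto c (𝓝 0) (𝓝 0) := by
    simpa [hc0] using hc.continuous.tendsto 0
  have hcbtend : Tendsto cb (𝓝 0) (𝓝 0) := by
    simpa [hcb0] using hcb.continuous.tendsto 0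
  have hcO : c =O[𝓝 0] fun t : ℝ => t := by
    simpa [hc0] using (hc.differentiable (by simp) 0).isBigO_sub
  have one : ∀ {f : ℝ → ℝ}, Continuous f → f =O[𝓝 0] fun _ => (1 : ℝ) := fun hf =>
    hf.continuousAt.isBigO_one ℝ
  have hstep : ∀ m ≤ r + 1, ∀ k, (fun t => deriv (fun t => c t k) t - deriv (fun t => cb t k) t)
      =O[𝓝 0] fun t => ‖t‖ ^ m := by
    intro m
    induction m with
    | zero =>
      intro _ k
      simpa using one ((hc' k).continuous.sub (hcb' k).continuous)
    | succ m ih =>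
      intro hm k
      have hD := ih (by omega)
      have hpow : ∀ {p q : ℕ}, p ≤ q → (fun t : ℝ => ‖t‖ ^ q) =O[𝓝 0] fun t : ℝ => ‖t‖ ^ p :=
        fun hpq => IsBigO.of_bound 1 (by
          filter_upwards [Metric.ball_mem_nhds (0 : ℝ) one_pos] with t ht
          rw [norm_pow, norm_pow, norm_norm, one_mul]
          exact pow_le_pow_of_le_one (norm_nonneg t) (mem_ball_zero_iff.1 ht).le hpq)
      have hcc : (fun t => c t - cb t) =O[𝓝 0] fun t => ‖t‖ ^ m :=
        (hsub hD).trans (hpow m.le_succ)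
      have hG : ∀ i j, (fun t => Γ k i j (c t) - Γb k i j (cb t)) =O[𝓝 0] fun t => ‖t‖ ^ m := by
        intro i j
        have h1 : (fun t => Γ k i j (c t) - Γb k i j (c t)) =O[𝓝 0] fun t => ‖t‖ ^ m :=
          (((hΓΓ k i j).comp_tendsto hctend).trans (hcO.norm_norm.pow r)).trans (hpow (by omega))
        have h2 : (fun t => Γb k i j (c t) - Γb k i j (cb t)) =O[𝓝 0] fun t => ‖t‖ ^ m :=
          ((((hΓb k i j).contDiffAt.hasStrictFDerivAt (x := 0) (by simp)).isBigO_sub.comp_tendsto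
            (hctend.prodMk_nhds hcbtend)).trans hcc)
        exact (h1.add h2).congr_left fun t => by ring
      refine integrate (fun t => ((hc' k).differentiable (by simp) t).hasDerivAt.sub
        ((hcb' k).differentiable (by simp) t).hasDerivAt) (sub_eq_zero.2 (hvel k)) ?_
      have hrhs : (fun t => ∑ i, ∑ j,
          (Γ k i j (c t) * deriv (fun t => c t i) t * deriv (fun t => c t j) t -
            Γb k i j (cb t) * deriv (fun t => cb t i) t * deriv (fun t => cb t j) t))
          =O[𝓝 0] fun t => ‖t‖ ^ m := by
        refine IsBigO.fun_sum fun i _ => IsBigO.fun_sum fun j _ => ?_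
        refine isBigO_mul_sub_mul (isBigO_mul_sub_mul (hG i j) (hD i) ?_ ?_) (hD j) ?_ ?_
        · exact one ((hΓ k i j).continuous.comp hc.continuous)
        · exact one (hcb' i).continuous
        · exact one (((hΓ k i j).continuous.comp hc.continuous).mul (hc' i).continuous)
        · exact one (hcb' j).continuous
      refine hrhs.neg_left.congr_left fun t => ?_
      simp only [Finset.sum_sub_distrib]
      linarith [hgeo t k, hgeob t k]
  exact hsub (hstep (r + 1) le_rfl)

end Geodesics

/-- If two semi-Riemannian metrics `g`, `ḡ` (written in a chart, with smooth,
symmetric, everywhere nondegenerate coefficient functions) have the same `r`-jet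
at the point `0`, then their exponential maps at `0` have the same `(r+1)`-jet
at `0 ∈ T₀`. Here the exponential map `Exp` of a metric with Christoffel symbols
`Γ` is characterized by `Exp 0 = 0` and the fact that for each tangent vector `v`
the radial curve `t ↦ Exp (t • v)` is a geodesic with initial velocity `v`. -/
theorem stmt16 (n r : ℕ)
    (g gb : Fin n → Fin n → (Fin n → ℝ) → ℝ)
    (Γ Γb : Fin n → Fin n → Fin n → (Fin n → ℝ) → ℝ)
    (Exp Expb : (Fin n → ℝ) → (Fin n → ℝ))
    (hg : ∀ i j, ContDiff ℝ (⊤ : ℕ∞) (g i j)) (hgb : ∀ i j, ContDiff ℝ (⊤ : ℕ∞) (gb i j))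
    (hgsym : ∀ i j x, g i j x = g j i x) (hgbsym : ∀ i j x, gb i j x = gb j i x)
    (hgnd : ∀ x, IsUnit (Matrix.of fun i j => g i j x))
    (hgbnd : ∀ x, IsUnit (Matrix.of fun i j => gb i j x))
    -- `Γ` and `Γb` are the Christoffel symbols of `g` and `gb`:
    (hΓ : ∀ (x : Fin n → ℝ) (k i j : Fin n),
      ∑ l : Fin n, g k l x * Γ l i j x =
        (1 / 2) * (fderiv ℝ (g j k) x (Pi.single i 1) +
          fderiv ℝ (g i k) x (Pi.single j 1) -
          fderiv ℝ (g i j) x (Pi.single k 1)))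
    (hΓb : ∀ (x : Fin n → ℝ) (k i j : Fin n),
      ∑ l : Fin n, gb k l x * Γb l i j x =
        (1 / 2) * (fderiv ℝ (gb j k) x (Pi.single i 1) +
          fderiv ℝ (gb i k) x (Pi.single j 1) -
          fderiv ℝ (gb i j) x (Pi.single k 1)))
    -- `Exp` and `Expb` are the exponential maps of `g` and `gb` at `0`:
    (hE : ContDiff ℝ (⊤ : ℕ∞) Exp) (hEb : ContDiff ℝ (⊤ : ℕ∞) Expb)
    (hE0 : Exp 0 = 0) (hEb0 : Expb 0 = 0)
    (hEvel : ∀ (v : Fin n → ℝ) (k : Fin n),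
      deriv (fun t : ℝ => Exp (t • v) k) 0 = v k)
    (hEbvel : ∀ (v : Fin n → ℝ) (k : Fin n),
      deriv (fun t : ℝ => Expb (t • v) k) 0 = v k)
    (hEgeo : ∀ (v : Fin n → ℝ) (t : ℝ) (k : Fin n),
      deriv (deriv (fun t : ℝ => Exp (t • v) k)) t +
        ∑ i : Fin n, ∑ j : Fin n, Γ k i j (Exp (t • v)) *
          deriv (fun t : ℝ => Exp (t • v) i) t *
          deriv (fun t : ℝ => Exp (t • v) j) t = 0)
    (hEbgeo : ∀ (v : Fin n → ℝ) (t : ℝ) (k : Fin n),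
      deriv (deriv (fun t : ℝ => Expb (t • v) k)) t +
        ∑ i : Fin n, ∑ j : Fin n, Γb k i j (Expb (t • v)) *
          deriv (fun t : ℝ => Expb (t • v) i) t *
          deriv (fun t : ℝ => Expb (t • v) j) t = 0)
    -- the metrics have the same `r`-jet at `0`:
    (hjet : ∀ s ≤ r, ∀ i j,
      iteratedFDeriv ℝ s (g i j) 0 = iteratedFDeriv ℝ s (gb i j) 0) :
    -- then the exponential maps have the same `(r+1)`-jet at `0`:
    ∀ s ≤ r + 1, iteratedFDeriv ℝ s Exp 0 = iteratedFDeriv ℝ s Expb 0 := by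
  intro s hs
  have hline : ∀ {G : (Fin n → ℝ) → Fin n → ℝ}, ContDiff ℝ (⊤ : ℕ∞) G → ∀ v,
      ContDiff ℝ (⊤ : ℕ∞) fun t : ℝ => G (t • v) :=
    fun hG v => hG.comp (contDiff_id.smul contDiff_const)
  have hzero := iteratedFDeriv_eq_zero_of_isBigO_lines (hE.sub hEb) (fun v =>
    isBigO_geodesic_sub (contDiff_christoffel hg hgnd hΓ) (contDiff_christoffel hgb hgbnd hΓb)
      (isBigO_christoffel_sub hg hgb hgnd hgbnd hΓ hΓb hjet) (hline hE v) (hline hEb v)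
      (by simpa using hE0) (by simpa using hEb0) (fun k => (hEvel v k).trans (hEbvel v k).symm)
      (hEgeo v) (hEbgeo v)) s (Nat.lt_succ_of_le hs)
  rwa [← Pi.sub_def, iteratedFDeriv_sub_apply (hE.contDiffAt.of_le (by exact_mod_cast le_top))
    (hEb.contDiffAt.of_le (by exact_mod_cast le_top)), sub_eq_zero] at hzero
end
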